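/- Let X be a metrizable topological space, F a nonempty closed subset of X such that the subspace X \ F is ultranormal, and fix η > 0. Then there exists a map Ξ : Met(F) → Met(X) satisfying properties (1)–(4) (extension, sup-distance isometry, monotonicity, and compatibility with pointwise maxima) and, in addition, for every d ∈ Met(F) the set F is η-dense in (X, Ξ(d)): for every x ∈ X there exists a ∈ F with Ξ(d)(x, a) ≤ η. -/

import Mathlib

/-- A topological space is *ultranormal* if every pair of disjoint closed sets can be
separated by a clopen set. -/
def Ultranormal (X : Type*) [TopologicalSpace X] : Prop :=
  ∀ A B : Set X, IsClosed A → IsClosed B → Disjoint A B →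
    ∃ C : Set X, IsClopen C ∧ A ⊆ C ∧ Disjoint C B

/-- `d` belongs to `Met(Y)`: it is a metric on `Y` (as a bare function) whose metric
topology coincides with the given topology of `Y`. -/
def IsCompatMetric (Y : Type*) [TopologicalSpace Y] (d : Y → Y → ℝ) : Prop :=
  (∀ x y, 0 ≤ d x y) ∧ (∀ x y, d x y = d y x) ∧
  (∀ x y z, d x z ≤ d x y + d y z) ∧ (∀ x y, d x y = 0 ↔ x = y) ∧
  (∀ x : Y, ∀ s : Set Y, s ∈ nhds x ↔ ∃ ε > 0, {y : Y | d x y < ε} ⊆ s)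

open Set Metric Topology

/-- In an ultranormal paracompact space, every open cover admits a locally constant choice of a
member of the cover, i.e. it is refined by a partition into clopen sets. -/
theorem Ultranormal.exists_isLocallyConstant_mem {Y ι : Type*} [TopologicalSpace Y]
    [T2Space Y] [ParacompactSpace Y] (hY : Ultranormal Y) (U : ι → Set Y)
    (hUo : ∀ i, IsOpen (U i)) (hUc : ⋃ i, U i = univ) :
    ∃ g : Y → ι, IsLocallyConstant g ∧ ∀ y, y ∈ U (g y) := by
  classical
  obtain ⟨V, hVo, hVc, hVf, hVU⟩ := precise_refinement U hUo hUc
  obtain ⟨W, hWc, hWcl, hWV⟩ :=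
    exists_iUnion_eq_closed_subset hVo (fun y => hVf.point_finite y) hVc
  have hC : ∀ i, ∃ C : Set Y, IsClopen C ∧ W i ⊆ C ∧ C ⊆ V i := fun i => by
    obtain ⟨C, hC, hWC, hCV⟩ := hY (W i) (V i)ᶜ (hWcl i) (hVo i).isClosed_compl
      (disjoint_compl_right_iff_subset.2 (hWV i))
    exact ⟨C, hC, hWC, disjoint_compl_right_iff_subset.1 hCV⟩
  choose C hCclopen hWC hCV using hC
  have hCf : LocallyFinite C := hVf.subset hCV
  have hne : ∀ y, {i | y ∈ C i}.Nonempty := fun y => by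
    obtain ⟨i, hi⟩ := mem_iUnion.1 (hWc ▸ mem_univ y : y ∈ ⋃ i, W i)
    exact ⟨i, hWC i hi⟩
  have wf : WellFounded (WellOrderingRel : ι → ι → Prop) := WellOrderingRel.isWellOrder.wf
  refine ⟨fun y => wf.min {i | y ∈ C i} (hne y), ?_, fun y =>
    hVU _ (hCV _ (wf.min_mem _ (hne y)))⟩
  rw [IsLocallyConstant.iff_isOpen_fiber]
  intro i
  have hfiber : {y | wf.min {i | y ∈ C i} (hne y) = i} =
      C i \ ⋃ j : {j // WellOrderingRel j i}, C j := by
    ext y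
    simp only [mem_ofPred_eq, mem_sdiff, mem_iUnion, not_exists]
    constructor
    · rintro rfl
      exact ⟨wf.min_mem _ (hne y), fun j hj => wf.not_lt_min _ hj j.2⟩
    · rintro ⟨hi, hj⟩
      have hmin := wf.min_mem _ (hne y)
      rcases trichotomous_of WellOrderingRel (wf.min {i | y ∈ C i} (hne y)) i with h | h | h
      · exact (hj ⟨_, h⟩ hmin).elim
      · exact h
      · exact (wf.not_lt_min {i | y ∈ C i} hi h).elim
  change IsOpen {y | wf.min {i | y ∈ C i} (hne y) = i}
  rw [hfiber]
  exact (hCclopen i).isOpen.sdiff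
    ((hCf.comp_injective Subtype.val_injective).isClosed_iUnion fun j => (hCclopen j).isClosed)

/-- A nonempty closed subset of a metric space with ultranormal complement is a retract, by a
retraction moving each point by at most a multiple of its distance to the subset. -/
theorem exists_retraction_dist_le {X : Type*} [MetricSpace X] {F : Set X} (hFne : F.Nonempty)
    (hFcl : IsClosed F) (hun : Ultranormal ↥(Fᶜ)) :
    ∃ r : X → F, Continuous r ∧ (∀ a : F, r a = a) ∧
      ∀ x, dist x (r x : X) ≤ 3 * infDist x F := by
  classical
  have hpos : ∀ x : ↥(Fᶜ), 0 < infDist (x : X) F := fun x =>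
    (hFcl.notMem_iff_infDist_pos hFne).1 x.2
  obtain ⟨g, hg, hgU⟩ := hun.exists_isLocallyConstant_mem
    (fun i : ↥(Fᶜ) => ball i (infDist (i : X) F / 4)) (fun _ => isOpen_ball)
    (iUnion_eq_univ_iff.2 fun y => ⟨y, mem_ball_self (by linarith [hpos y])⟩)
  have hnear : ∀ i : ↥(Fᶜ), ∃ a : F, dist (i : X) a < 2 * infDist (i : X) F := fun i => by
    obtain ⟨a, ha, h⟩ := (infDist_lt_iff (r := 2 * infDist (i : X) F) hFne).1
      (by linarith [hpos i])
    exact ⟨⟨a, ha⟩, h⟩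
  choose a ha using hnear
  let r : X → F := fun x => if h : x ∈ F then ⟨x, h⟩ else a (g ⟨x, h⟩)
  have hrF : ∀ b : F, r b = b := fun b => by simp [r]
  have hrd : ∀ x, dist x (r x : X) ≤ 3 * infDist x F := fun x => by
    by_cases h : x ∈ F
    · have : r x = ⟨x, h⟩ := hrF ⟨x, h⟩
      simp [this, infDist_nonneg]
    · have hr : r x = a (g ⟨x, h⟩) := by simp [r, h]
      have hx : dist x (g ⟨x, h⟩ : X) < infDist (g ⟨x, h⟩ : X) F / 4 := hgU ⟨x, h⟩
      have htri := dist_triangle x (g ⟨x, h⟩ : X) (a (g ⟨x, h⟩))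
      have hinf := infDist_le_infDist_add_dist (s := F) (x := (g ⟨x, h⟩ : X)) (y := x)
      rw [dist_comm (g ⟨x, h⟩ : X) x] at hinf
      rw [hr]
      linarith [ha (g ⟨x, h⟩)]
  refine ⟨r, continuous_iff_continuousAt.2 fun x => ?_, hrF, hrd⟩
  by_cases h : x ∈ F
  · rw [Metric.continuousAt_iff]
    intro ε hε
    refine ⟨ε / 4, by linarith, fun {y} hy => ?_⟩
    have hrx : r x = ⟨x, h⟩ := hrF ⟨x, h⟩
    rw [hrx, Subtype.dist_eq]
    have htri := dist_triangle_left (r y : X) x y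
    linarith [hrd y, infDist_le_dist_of_mem (x := y) h]
  · have hgc : ContinuousOn r Fᶜ := by
      rw [continuousOn_iff_continuous_domRestrict]
      have : Fᶜ.domRestrict r = a ∘ g := funext fun y => dif_neg y.2
      rw [this]
      exact (hg.comp a).continuous
    exact hgc.continuousAt (hFcl.isOpen_compl.mem_nhds h)

/-- The pseudometric obtained from the metric by collapsing `F` to a point, truncated at `η`. -/
noncomputable def collapseDist {X : Type*} [MetricSpace X] (F : Set X) (η : ℝ) (x y : X) : ℝ :=
  min η (min (dist x y) (infDist x F + infDist y F))

section collapseDist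

variable {X : Type*} [MetricSpace X] {F : Set X} {η : ℝ}

theorem collapseDist_nonneg (hη : 0 < η) (x y : X) : 0 ≤ collapseDist F η x y :=
  le_min hη.le (le_min dist_nonneg (add_nonneg infDist_nonneg infDist_nonneg))

theorem collapseDist_comm (x y : X) : collapseDist F η x y = collapseDist F η y x := by
  simp only [collapseDist, dist_comm x y, add_comm (infDist x F)]

theorem collapseDist_self (hη : 0 < η) (x : X) : collapseDist F η x x = 0 := by
  simp [collapseDist, hη.le, infDist_nonneg]

theorem collapseDist_of_mem (hη : 0 < η) {x y : X} (hx : x ∈ F) (hy : y ∈ F) :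
    collapseDist F η x y = 0 := by
  simp [collapseDist, infDist_zero_of_mem hx, infDist_zero_of_mem hy, hη.le]

theorem collapseDist_le_dist (x y : X) : collapseDist F η x y ≤ dist x y :=
  (min_le_right _ _).trans (min_le_left _ _)

theorem collapseDist_triangle (hη : 0 < η) (x y z : X) :
    collapseDist F η x z ≤ collapseDist F η x y + collapseDist F η y z := by
  have hxyz := dist_triangle x y z
  have hxy := infDist_le_infDist_add_dist (s := F) (x := x) (y := y)
  have hzy := infDist_le_infDist_add_dist (s := F) (x := z) (y := y)
  rw [dist_comm z y] at hzy
  have hx : 0 ≤ infDist x F := infDist_nonneg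
  have hy : 0 ≤ infDist y F := infDist_nonneg
  have hz : 0 ≤ infDist z F := infDist_nonneg
  have dxy : 0 ≤ dist x y := dist_nonneg
  have dyz : 0 ≤ dist y z := dist_nonneg
  simp only [collapseDist]
  grind

theorem dist_lt_of_collapseDist_lt {x y : X} {ε : ℝ} (hεη : ε ≤ η) (hεx : ε ≤ infDist x F)
    (h : collapseDist F η x y < ε) : dist x y < ε := by
  have hy : 0 ≤ infDist y F := infDist_nonneg
  simp only [collapseDist] at h
  grind

theorem infDist_lt_of_collapseDist_lt {x y : X} {ε : ℝ} (hεη : ε ≤ η) (hx : x ∈ F)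
    (h : collapseDist F η x y < ε) : infDist y F < ε := by
  have hy : infDist y F ≤ dist x y := dist_comm x y ▸ infDist_le_dist_of_mem hx
  simp only [collapseDist, infDist_zero_of_mem hx] at h
  grind

/-- Pulling a compatible metric on `F` back along a suitable retraction and adding the collapsed
distance yields a compatible metric on the whole space. -/
theorem IsCompatMetric.add_collapseDist (hFne : F.Nonempty) (hFcl : IsClosed F) (hη : 0 < η)
    {r : X → F} (hrc : Continuous r) (hrF : ∀ a : F, r a = a)
    (hrd : ∀ x, dist x (r x : X) ≤ 3 * infDist x F) {d : F → F → ℝ} (hd : IsCompatMetric F d) :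
    IsCompatMetric X fun x y => d (r x) (r y) + collapseDist F η x y := by
  obtain ⟨hd0, hdc, hdt, hde, hdn⟩ := hd
  have hD0 : ∀ x y : X, 0 ≤ collapseDist F η x y := collapseDist_nonneg hη
  have hpos : ∀ x ∉ F, 0 < infDist x F := fun x hx => (hFcl.notMem_iff_infDist_pos hFne).1 hx
  refine ⟨fun x y => add_nonneg (hd0 _ _) (hD0 _ _),
    fun x y => by simp only [hdc (r x), collapseDist_comm x], fun x y z => ?_, fun x y => ⟨fun h => ?_, ?_⟩,
    fun x s => ⟨fun hs => ?_, ?_⟩⟩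
  · linarith [hdt (r x) (r y) (r z), collapseDist_triangle (F := F) hη x y z]
  · have hr : r x = r y := (hde _ _).1 (by linarith [hd0 (r x) (r y), hD0 x y])
    have hD : collapseDist F η x y = 0 := by linarith [hd0 (r x) (r y), hD0 x y]
    by_cases hx : x ∈ F
    · by_cases hy : y ∈ F
      · have hrx : r x = ⟨x, hx⟩ := hrF ⟨x, hx⟩
        have hry : r y = ⟨y, hy⟩ := hrF ⟨y, hy⟩
        exact congrArg Subtype.val (hrx.symm.trans (hr.trans hry))
      · have := infDist_lt_of_collapseDist_lt (min_le_left η (infDist y F)) hx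
          (hD.trans_lt (lt_min hη (hpos y hy)))
        exact absurd this (not_lt.2 (min_le_right _ _))
    · by_contra hxy
      have hlt : 0 < min η (min (infDist x F) (dist x y)) :=
        lt_min hη (lt_min (hpos x hx) (dist_pos.2 hxy))
      have := dist_lt_of_collapseDist_lt (min_le_left _ _)
        ((min_le_right _ _).trans (min_le_left _ _)) (hD.trans_lt hlt)
      exact absurd this (not_lt.2 ((min_le_right _ _).trans (min_le_right _ _)))
  · rintro rfl
    simp only [(hde _ _).2 rfl, collapseDist_self hη, add_zero]
  · obtain ⟨δ, hδ, hδs⟩ := Metric.mem_nhds_iff.1 hs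
    by_cases hx : x ∈ F
    · obtain ⟨ε, hε, hεs⟩ := (hdn (r x) _).1 (ball_mem_nhds (r x) (half_pos hδ))
      refine ⟨min ε (min η (δ / 6)), lt_min hε (lt_min hη (by linarith)), fun y hy => hδs ?_⟩
      simp only [mem_ofPred_eq] at hy
      have hd' : dist (r y) (r x) < δ / 2 :=
        hεs (show d (r x) (r y) < ε by
          linarith [hD0 x y, min_le_left ε (min η (δ / 6))])
      have hf : infDist y F < min η (δ / 6) :=
        infDist_lt_of_collapseDist_lt (min_le_left _ _) hx
          (by linarith [hd0 (r x) (r y), min_le_right ε (min η (δ / 6))])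
      have hrx : r x = ⟨x, hx⟩ := hrF ⟨x, hx⟩
      rw [hrx, Subtype.dist_eq] at hd'
      rw [mem_ball]
      linarith [dist_triangle y (r y : X) x, hrd y, min_le_right η (δ / 6)]
    · refine ⟨min δ (min η (infDist x F)), lt_min hδ (lt_min hη (hpos x hx)),
        fun y hy => hδs ?_⟩
      simp only [mem_ofPred_eq] at hy
      rw [mem_ball, dist_comm]
      exact (dist_lt_of_collapseDist_lt ((min_le_right _ _).trans (min_le_left _ _))
        ((min_le_right _ _).trans (min_le_right _ _))
        (by linarith [hd0 (r x) (r y)])).trans_le (min_le_left _ _)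
  · rintro ⟨ε, hε, hεs⟩
    have hr : {b | d (r x) b < ε / 2} ∈ 𝓝 (r x) :=
      (hdn (r x) _).2 ⟨ε / 2, half_pos hε, Subset.rfl⟩
    filter_upwards [hrc.continuousAt hr, ball_mem_nhds x (half_pos hε)] with y hy hxy
    refine hεs ?_
    simp only [mem_preimage, mem_ofPred_eq, mem_ball'] at hy hxy ⊢
    linarith [collapseDist_le_dist (F := F) (η := η) x y]

end collapseDist

theorem exists_metric_extensor_dense {X : Type*} [TopologicalSpace X]
    [TopologicalSpace.MetrizableSpace X]
    (F : Set X) (hFne : F.Nonempty) (hFcl : IsClosed F)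
    (hun : Ultranormal ↥(Fᶜ)) (η : ℝ) (hη : 0 < η) :
    ∃ Ξ : (↥F → ↥F → ℝ) → (X → X → ℝ),
      (∀ d, IsCompatMetric ↥F d → IsCompatMetric X (Ξ d)) ∧
      -- (1) extension
      (∀ d, IsCompatMetric ↥F d → ∀ a b : ↥F, Ξ d (a : X) (b : X) = d a b) ∧
      -- (2) sup-distance isometry (in [0, ∞])
      (∀ d e, IsCompatMetric ↥F d → IsCompatMetric ↥F e →
        (⨆ x : X, ⨆ y : X, ENNReal.ofReal |Ξ d x y - Ξ e x y|) =
          (⨆ a : ↥F, ⨆ b : ↥F, ENNReal.ofReal |d a b - e a b|)) ∧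
      -- (3) monotonicity
      (∀ d e, IsCompatMetric ↥F d → IsCompatMetric ↥F e →
        (∀ a b : ↥F, d a b ≤ e a b) → ∀ x y : X, Ξ d x y ≤ Ξ e x y) ∧
      -- (4) compatibility with pointwise maxima
      (∀ d e, IsCompatMetric ↥F d → IsCompatMetric ↥F e →
        ∀ x y : X, Ξ (fun a b => max (d a b) (e a b)) x y = max (Ξ d x y) (Ξ e x y)) ∧
      -- F is η-dense in (X, Ξ d)
      (∀ d, IsCompatMetric ↥F d → ∀ x : X, ∃ a ∈ F, Ξ d x a ≤ η) := by
  let _ := TopologicalSpace.metrizableSpaceMetric X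
  obtain ⟨r, hrc, hrF, hrd⟩ := exists_retraction_dist_le hFne hFcl hun
  have hext : ∀ (d : F → F → ℝ) (a b : F),
      d (r a) (r b) + collapseDist F η (a : X) b = d a b := fun d a b => by
    rw [hrF, hrF, collapseDist_of_mem hη a.2 b.2, add_zero]
  refine ⟨fun d x y => d (r x) (r y) + collapseDist F η x y,
    fun d hd => hd.add_collapseDist hFne hFcl hη hrc hrF hrd, fun d _ => hext d,
    fun d e _ _ => le_antisymm ?_ ?_, fun d e _ _ h x y => ?_, fun d e _ _ x y => ?_,
    fun d hd x => ⟨r x, (r x).2, ?_⟩⟩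
  · refine iSup₂_le fun x y => ?_
    rw [add_sub_add_right_eq_sub]
    exact le_iSup₂ (f := fun a b : F => ENNReal.ofReal |d a b - e a b|) (r x) (r y)
  · refine iSup₂_le fun a b => ?_
    rw [← hext d, ← hext e]
    exact le_iSup₂ (f := fun x y : X => ENNReal.ofReal
      |d (r x) (r y) + collapseDist F η x y - (e (r x) (r y) + collapseDist F η x y)|) (a : X) b
  · exact add_le_add_left (h _ _) _
  · exact max_add_add_right _ _ _ |>.symm
  · simp only [hrF, (hd.2.2.2.1 _ _).2 rfl, zero_add]
    exact min_le_left _ _
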